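/- Let X₁, …, Xₙ be independent with regular cdfs F₁, …, Fₙ (densities fᵢ, finite expectations, increasing virtual values ψᵢ) and let rᵢ = ψᵢ⁻¹(0) be the monopoly prices. In the lazy second-price auction with reserve prices (r₁, …, rₙ), the overall highest bidder i* wins iff X_{i*} ≥ r_{i*} and pays max(r_{i*}, max_{j ≠ i*} X_j). Its expected revenue R_lazy = E[ max(r_{i*}, max_{j≠i*} X_j) · 1{X_{i*} ≥ r_{i*}} ] is a 2-approximation of the Myerson revenue: R_lazy ≥ (1/2) · E[ max(0, maxᵢ ψᵢ(Xᵢ)) ]. -/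

import Mathlib

open MeasureTheory Set

/-- The probability measure of a bidder whose value has density `f` on `[0,∞)`. -/
noncomputable def valueMeasure (f : ℝ → ℝ) : Measure ℝ :=
  (volume.restrict (Ici 0)).withDensity fun x => ENNReal.ofReal (f x)

open Filter Topology in
/-- Restriction of the value measure to a half-line. -/
lemma val_restrict (f : ℝ → ℝ) {p : ℝ} (hp : 0 ≤ p) :
    (valueMeasure f).restrict (Ioi p)
      = (volume.restrict (Ioi p)).withDensity fun x => ENNReal.ofReal (f x) := by
  have : Ioi p ∩ Ici 0 = Ioi p := inter_eq_left.2 fun x hx => hp.trans (le_of_lt hx)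
  rw [valueMeasure, restrict_withDensity measurableSet_Ioi,
    Measure.restrict_restrict measurableSet_Ioi, this]

lemma val_integrable (f : ℝ → ℝ) (hf : Continuous f) (hpos : ∀ x, 0 ≤ x → 0 < f x)
    {p : ℝ} (hp : 0 ≤ p) (g : ℝ → ℝ) :
    IntegrableOn g (Ioi p) (valueMeasure f) ↔ IntegrableOn (fun x => f x * g x) (Ioi p) := by
  rw [IntegrableOn, val_restrict f hp,
    integrable_withDensity_iff_integrable_smul' (by fun_prop) (by simp)]
  apply integrable_congr
  filter_upwards [ae_restrict_mem measurableSet_Ioi] with x hx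
  rw [ENNReal.toReal_ofReal (hpos x (hp.trans (le_of_lt hx))).le, smul_eq_mul]

lemma val_integral (f : ℝ → ℝ) (hf : Continuous f) (hpos : ∀ x, 0 ≤ x → 0 < f x)
    {p : ℝ} (hp : 0 ≤ p) (g : ℝ → ℝ) :
    ∫ x in Ioi p, g x ∂(valueMeasure f) = ∫ x in Ioi p, f x * g x := by
  rw [val_restrict f hp,
    integral_withDensity_eq_integral_toReal_smul (by fun_prop) (by simp)]
  apply integral_congr_ae
  filter_upwards [ae_restrict_mem measurableSet_Ioi] with x hx
  rw [ENNReal.toReal_ofReal (hpos x (hp.trans (le_of_lt hx))).le, smul_eq_mul]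

lemma val_restrict_zero (f : ℝ → ℝ) : (valueMeasure f).restrict (Ioi 0) = valueMeasure f := by
  rw [val_restrict f le_rfl, valueMeasure, restrict_Ioi_eq_restrict_Ici]

lemma val_ae_pos (f : ℝ → ℝ) : ∀ᵐ x ∂(valueMeasure f), 0 < x := by
  rw [← val_restrict_zero]
  exact ae_restrict_mem measurableSet_Ioi

lemma val_noatom (f : ℝ → ℝ) (a : ℝ) : valueMeasure f {a} = 0 := by
  have h : valueMeasure f ≪ volume.restrict (Ici 0) := withDensity_absolutelyContinuous _ _
  exact h (by simp)

open Filter Topology in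
/-- All one-dimensional facts. -/
lemma one_dim (F f ψ : ℝ → ℝ) (hf : Continuous f) (hpos : ∀ x, 0 ≤ x → 0 < f x)
    (hF : ∀ x, F x = ∫ t in (0:ℝ)..x, f t)
    (hψ : ∀ x, ψ x = x - (1 - F x) / f x)
    (hprob : IsProbabilityMeasure (valueMeasure f))
    (hexp : Integrable (fun x => x) (valueMeasure f)) :
    Measurable ψ ∧ Integrable ψ (valueMeasure f) ∧ (∀ x, 0 ≤ x → ψ x ≤ x) ∧
    ∀ p, 0 ≤ p → ∫ x in Ioi p, ψ x ∂(valueMeasure f) = ∫ x in Ioi p, p ∂(valueMeasure f) := by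
  have hFd : ∀ x, HasDerivAt F (f x) x := by
    intro x
    have : F = fun x => ∫ t in (0:ℝ)..x, f t := funext hF
    rw [this]
    exact hf.integral_hasStrictDerivAt 0 x |>.hasDerivAt
  have hFc : Continuous F := continuous_iff_continuousAt.2 fun x => (hFd x).continuousAt
  have hψm : Measurable ψ := by
    have : ψ = fun x => x - (1 - F x) / f x := funext hψ
    rw [this]
    have := hFc.measurable
    have := hf.measurable
    fun_prop
  have hfi : IntegrableOn f (Ioi 0) := by
    have := (val_integrable f hf hpos le_rfl (fun _ => 1)).1 (integrable_const (1:ℝ)).integrableOn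
    simpa using this
  have hf1 : ∫ x in Ioi 0, f x = 1 := by
    have := val_integral f hf hpos le_rfl (fun _ => 1)
    rw [val_restrict_zero] at this
    simpa using this.symm
  have hxi : IntegrableOn (fun x => f x * x) (Ioi 0) :=
    (val_integrable f hf hpos le_rfl (fun x => x)).1 hexp.integrableOn
  have hsub : ∀ p : ℝ, 0 ≤ p → Ioi p ⊆ Ioi 0 := fun p hp => Ioi_subset_Ioi hp
  have htail : ∀ p, 0 ≤ p → 1 - F p = ∫ x in Ioi p, f x := by
    intro p hp
    have := intervalIntegral.integral_interval_add_Ioi hfi (hfi.mono_set (hsub p hp))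
    rw [hF, ← hf1, ← this]; ring
  have htail0 : ∀ p, 0 ≤ p → 0 ≤ 1 - F p := by
    intro p hp
    rw [htail p hp]
    exact setIntegral_nonneg measurableSet_Ioi fun x hx => (hpos x (hp.trans (le_of_lt hx))).le
  have hxtail : ∀ p, 0 ≤ p → ∫ x in Ioi p, f x * x
      = (∫ x in Ioi 0, f x * x) - ∫ x in (0:ℝ)..p, f x * x := by
    intro p hp
    have := intervalIntegral.integral_interval_add_Ioi hxi (hxi.mono_set (hsub p hp))
    rw [← this]; ring
  have hI := intervalIntegral_tendsto_integral_Ioi (0:ℝ) hxi tendsto_id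
  have hlim : Tendsto (fun x => x * (1 - F x)) atTop (𝓝 0) := by
    have h2 : Tendsto (fun p => (∫ x in Ioi 0, f x * x) - ∫ x in (0:ℝ)..p, f x * x) atTop (𝓝 0) := by
      simpa using (tendsto_const_nhds (x := ∫ x in Ioi 0, f x * x)).sub hI
    refine tendsto_of_tendsto_of_tendsto_of_le_of_le' tendsto_const_nhds h2 ?_ ?_
    · filter_upwards [eventually_ge_atTop 0] with p hp
      exact mul_nonneg hp (htail0 p hp)
    · filter_upwards [eventually_ge_atTop 0] with p hp
      rw [← hxtail p hp, htail p hp, ← integral_const_mul]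
      refine setIntegral_mono_on ((hfi.mono_set (hsub p hp)).const_mul p)
        (hxi.mono_set (hsub p hp)) measurableSet_Ioi fun x hx => ?_
      have := (hpos x (hp.trans (le_of_lt hx)))
      have hx' : p < x := hx
      nlinarith
  have hder : ∀ x, HasDerivAt (fun x => x * (1 - F x)) (1 - F x - f x * x) x := by
    intro x
    have := (hasDerivAt_id x).mul ((hasDerivAt_const x (1:ℝ)).sub (hFd x))
    refine HasDerivAt.congr_deriv this ?_
    simp only [id, Pi.sub_apply]; ring
  have hti : IntegrableOn (fun x => 1 - F x) (Ioi 0) := by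
    refine integrableOn_Ioi_deriv_of_nonneg'
      (g := fun x => x * (1 - F x) + ∫ t in (0:ℝ)..x, f t * t) (l := 0 + ∫ x in Ioi 0, f x * x)
      (fun x _ => ?_) (fun x hx => htail0 x (le_of_lt hx)) (hlim.add hI)
    have h1 : HasDerivAt (fun x => ∫ t in (0:ℝ)..x, f t * t) (f x * x) x :=
      ((hf.mul continuous_id).integral_hasStrictDerivAt 0 x).hasDerivAt
    refine HasDerivAt.congr_deriv ((hder x).add h1) ?_
    ring
  have hfψ : ∀ x, 0 ≤ x → f x * ψ x = f x * x - (1 - F x) := by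
    intro x hx
    have := (hpos x hx).ne'
    rw [hψ]; field_simp
  have hψi : IntegrableOn (fun x => f x * ψ x) (Ioi 0) :=
    (hxi.sub hti).congr_fun (fun x hx => (hfψ x (le_of_lt hx)).symm) measurableSet_Ioi
  refine ⟨hψm, ?_, ?_, ?_⟩
  · have := (val_integrable f hf hpos le_rfl ψ).2 hψi
    rwa [IntegrableOn, val_restrict_zero] at this
  · intro x hx
    rw [hψ]
    have := div_nonneg (htail0 x hx) (hpos x hx).le
    linarith
  · intro p hp
    rw [val_integral f hf hpos hp, val_integral f hf hpos hp, integral_mul_const, ← htail p hp]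
    have := integral_Ioi_of_hasDerivAt_of_tendsto' (a := p) (fun x _ => hder x)
      ((hti.sub hxi).mono_set (hsub p hp)) hlim
    have h3 : ∫ x in Ioi p, f x * ψ x = - ∫ x in Ioi p, (1 - F x - f x * x) := by
      rw [← integral_neg]
      refine setIntegral_congr_fun measurableSet_Ioi fun x hx => ?_
      rw [hfψ x (hp.trans (le_of_lt hx))]; ring
    rw [h3, this]; ring

lemma slice_ineq (f ψ : ℝ → ℝ) (r : ℝ) (hr0 : 0 ≤ r) (hr : ψ r = 0)
    (hreg : StrictMonoOn ψ (Ici 0))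
    (hprob : IsProbabilityMeasure (valueMeasure f))
    (hψi : Integrable ψ (valueMeasure f))
    (hψp : ∀ p, 0 ≤ p →
      ∫ x in Ioi p, ψ x ∂(valueMeasure f) = ∫ x in Ioi p, p ∂(valueMeasure f))
    (m : ℝ) (hm : 0 ≤ m) :
    ∫ t, (if m < t then max 0 (ψ t) + m else 0) ∂(valueMeasure f)
      ≤ 2 * ∫ t, (if m < t ∧ r ≤ t then max r m else 0) ∂(valueMeasure f) := by
  have hq0 : 0 ≤ max r m := le_max_of_le_right hm
  have hR : ∫ t, (if m < t ∧ r ≤ t then max r m else 0) ∂(valueMeasure f)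
      = ∫ t in Ioi (max r m), ψ t ∂(valueMeasure f) := by
    rw [hψp _ hq0, ← integral_indicator measurableSet_Ioi]
    apply integral_congr_ae
    have : ∀ᵐ t ∂(valueMeasure f), t ≠ r := by
      have := val_noatom f r
      exact measure_eq_zero_iff_ae_notMem.1 this
    filter_upwards [this] with t ht
    have : (m < t ∧ r ≤ t) ↔ t ∈ Ioi (max r m) := by
      rw [mem_Ioi, max_lt_iff, and_comm]
      exact and_congr_left fun _ => ⟨fun h => lt_of_le_of_ne h ht.symm, le_of_lt⟩
    by_cases h : t ∈ Ioi (max r m)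
    · rw [if_pos (this.2 h), indicator_of_mem h]
    · rw [if_neg (this.not.2 h), indicator_of_notMem h]
  have hA : ∫ t in Ioi m, max 0 (ψ t) ∂(valueMeasure f)
      = ∫ t in Ioi (max r m), ψ t ∂(valueMeasure f) := by
    rw [← integral_indicator measurableSet_Ioi, ← integral_indicator measurableSet_Ioi]
    congr 1
    funext t
    by_cases h : m < t
    · rw [indicator_of_mem (show t ∈ Ioi m from h)]
      have ht0 : 0 ≤ t := hm.trans h.le
      by_cases h' : r < t
      · rw [indicator_of_mem (show t ∈ Ioi (max r m) from max_lt h' h), max_eq_right]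
        rw [← hr]
        exact (hreg hr0 ht0 h').le
      · rw [indicator_of_notMem (fun hh : t ∈ Ioi (max r m) => h' ((le_max_left _ _).trans_lt hh)),
          max_eq_left]
        rw [← hr]
        exact hreg.monotoneOn ht0 hr0 (not_lt.1 h')
    · rw [indicator_of_notMem (show t ∉ Ioi m from h),
        indicator_of_notMem (fun hh : t ∈ Ioi (max r m) => h ((le_max_right _ _).trans_lt hh))]
  have hmaxi : Integrable (fun t => max 0 (ψ t)) (valueMeasure f) :=
    (integrable_const (0:ℝ)).sup hψi
  have hB : ∫ t in Ioi m, m ∂(valueMeasure f) ≤ ∫ t in Ioi m, max 0 (ψ t) ∂(valueMeasure f) := by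
    rw [← hψp m hm]
    exact setIntegral_mono hψi.integrableOn hmaxi.integrableOn fun t => le_max_right _ _
  have hL : ∫ t, (if m < t then max 0 (ψ t) + m else 0) ∂(valueMeasure f)
      = ∫ t in Ioi m, max 0 (ψ t) ∂(valueMeasure f) + ∫ t in Ioi m, m ∂(valueMeasure f) := by
    rw [← integral_add hmaxi.integrableOn (integrable_const m), ← integral_indicator measurableSet_Ioi]
    congr 1
  rw [hL, hR, ← hA]
  linarith

lemma fub {k : ℕ} (μ : Fin (k + 1) → Measure ℝ) [∀ i, IsProbabilityMeasure (μ i)]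
    (i : Fin (k + 1)) (M : (Fin k → ℝ) → ℝ) (φ₁ φ₂ : ℝ → ℝ → ℝ)
    (h₁ : Integrable (fun x => φ₁ (x i) (M fun j => x (i.succAbove j))) (Measure.pi μ))
    (h₂ : Integrable (fun x => φ₂ (x i) (M fun j => x (i.succAbove j))) (Measure.pi μ))
    (h : ∀ᵐ y ∂(Measure.pi fun j => μ (i.succAbove j)),
      ∫ t, φ₁ t (M y) ∂(μ i) ≤ 2 * ∫ t, φ₂ t (M y) ∂(μ i)) :
    ∫ x, φ₁ (x i) (M fun j => x (i.succAbove j)) ∂(Measure.pi μ)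
      ≤ 2 * ∫ x, φ₂ (x i) (M fun j => x (i.succAbove j)) ∂(Measure.pi μ) := by
  have hmp := measurePreserving_piFinSuccAbove μ i
  have key : ∀ φ : ℝ → ℝ → ℝ,
      Integrable (fun x => φ (x i) (M fun j => x (i.succAbove j))) (Measure.pi μ) →
      Integrable (fun y => ∫ t, φ t (M y) ∂(μ i)) (Measure.pi fun j => μ (i.succAbove j)) ∧
      ∫ x, φ (x i) (M fun j => x (i.succAbove j)) ∂(Measure.pi μ)
        = ∫ y, ∫ t, φ t (M y) ∂(μ i) ∂(Measure.pi fun j => μ (i.succAbove j)) := by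
    intro φ hφ
    have hi : Integrable (fun z : ℝ × (Fin k → ℝ) => φ z.1 (M z.2))
        ((μ i).prod (Measure.pi fun j => μ (i.succAbove j))) :=
      (hmp.integrable_comp_emb (MeasurableEquiv.measurableEmbedding _)).1 hφ
    refine ⟨hi.integral_prod_right, ?_⟩
    rw [← integral_prod_symm _ hi]
    exact hmp.integral_comp' (fun z : ℝ × (Fin k → ℝ) => φ z.1 (M z.2))
  rw [(key φ₁ h₁).2, (key φ₂ h₂).2, ← integral_const_mul]
  exact integral_mono_ae (key φ₁ h₁).1 ((key φ₂ h₂).1.const_mul 2) h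

lemma no_tie {k : ℕ} (μ : Fin (k + 1) → Measure ℝ) [∀ i, IsProbabilityMeasure (μ i)]
    (i : Fin (k + 1)) (M : (Fin k → ℝ) → ℝ) (hM : Measurable M) (hna : ∀ a, μ i {a} = 0) :
    ∀ᵐ x ∂(Measure.pi μ), x i ≠ M fun j => x (i.succAbove j) := by
  have hmp := measurePreserving_piFinSuccAbove μ i
  have hs : MeasurableSet {z : ℝ × (Fin k → ℝ) | z.1 = M z.2} :=
    measurableSet_eq_fun measurable_fst (hM.comp measurable_snd)
  have h0 : ((μ i).prod (Measure.pi fun j => μ (i.succAbove j)))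
      {z : ℝ × (Fin k → ℝ) | z.1 = M z.2} = 0 := by
    rw [Measure.prod_apply_symm hs]
    have : ∀ y : Fin k → ℝ, (fun x => (x, y)) ⁻¹' {z : ℝ × (Fin k → ℝ) | z.1 = M z.2} = {M y} := by
      intro y; ext t; simp
    simp [this, hna]
  exact hmp.quasiMeasurePreserving.ae (measure_eq_zero_iff_ae_notMem.1 h0)

/-- **The lazy second-price auction with monopoly reserve prices is a 2-approximation of
the Myerson auction.**  Let `X₁,…,Xₙ` be independent with regular cdfs `Fᵢ` (virtual
values `ψᵢ`) and let `rᵢ = ψᵢ⁻¹(0)` be the monopoly prices.  In the lazy second-price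
auction the overall highest bidder `i* = w x` wins iff `x_{i*} ≥ r_{i*}`, paying
`max(r_{i*}, max_{j ≠ i*} x_j)`; the resulting expected revenue is at least half the
Myerson revenue `E[max(0, maxᵢ ψᵢ(Xᵢ))]`. -/
theorem lazy_second_price_monopoly_reserves_half_of_myerson
    (n : ℕ) (hn : 2 ≤ n)
    (F f ψ : Fin n → ℝ → ℝ)
    (hf_cont : ∀ i, Continuous (f i))
    (hf_pos : ∀ i x, 0 ≤ x → 0 < f i x)
    (hF : ∀ i x, F i x = ∫ t in (0:ℝ)..x, f i t)
    (hψ : ∀ i x, ψ i x = x - (1 - F i x) / f i x)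
    (hreg : ∀ i, StrictMonoOn (ψ i) (Ici 0))
    (μ : Fin n → Measure ℝ) (hμ : ∀ i, μ i = valueMeasure (f i))
    (hprob : ∀ i, IsProbabilityMeasure (μ i))
    (hexp : ∀ i, Integrable (fun x => x) (μ i))
    (r : Fin n → ℝ) (hr_nonneg : ∀ i, 0 ≤ r i) (hr_root : ∀ i, ψ i (r i) = 0)
    (w : (Fin n → ℝ) → Fin n)
    (hw_meas : ∀ i, MeasurableSet {x : Fin n → ℝ | w x = i})
    (hw_max : ∀ (x : Fin n → ℝ) (j : Fin n), x j ≤ x (w x)) :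
    (1 / 2 : ℝ) *
        (∫ x : Fin n → ℝ,
          max 0 (Finset.univ.sup' ⟨⟨0, by omega⟩, Finset.mem_univ _⟩ fun i => ψ i (x i))
          ∂Measure.pi μ)
      ≤ ∫ x : Fin n → ℝ,
          (if r (w x) ≤ x (w x) then
            max (r (w x))
              ((Finset.univ.erase (w x)).sup'
                (by
                  rw [← Finset.card_pos, Finset.card_erase_of_mem (Finset.mem_univ _),
                    Finset.card_univ, Fintype.card_fin]
                  omega)
                x)
          else 0)
          ∂Measure.pi μ := by

  obtain ⟨k, rfl⟩ : ∃ k, n = k + 2 := ⟨n - 2, by omega⟩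
  obtain rfl : μ = fun i => valueMeasure (f i) := funext hμ
  have h1 := fun i => one_dim (F i) (f i) (ψ i) (hf_cont i) (hf_pos i) (hF i) (hψ i)
    (hprob i) (hexp i)
  let M : (Fin (k + 1) → ℝ) → ℝ := fun y => Finset.univ.sup' Finset.univ_nonempty y
  have hMge : ∀ y j, y j ≤ M y := fun y j => Finset.le_sup' y (Finset.mem_univ j)
  have hMm : Measurable M := by
    have := Finset.measurable_sup' (s := (Finset.univ : Finset (Fin (k+1))))
      Finset.univ_nonempty (f := fun j (y : Fin (k+1) → ℝ) => y j)
      (fun j _ => measurable_pi_apply j)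
    convert this using 1
    funext y
    simp [M, Finset.sup'_apply]
  have hers : ∀ (x : Fin (k + 2) → ℝ) (i : Fin (k + 2)) (h : (Finset.univ.erase i).Nonempty),
      (Finset.univ.erase i).sup' h x = M fun j => x (i.succAbove j) := by
    intro x i h
    apply le_antisymm
    · refine Finset.sup'_le _ _ fun j hj => ?_
      obtain ⟨l, rfl⟩ := Fin.exists_succAbove_eq (Finset.ne_of_mem_erase hj)
      exact hMge (fun j => x (i.succAbove j)) l
    · refine Finset.sup'_le _ _ fun j _ => ?_
      exact Finset.le_sup' x (Finset.mem_erase.2 ⟨Fin.succAbove_ne i j, Finset.mem_univ _⟩)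
  have hMabs : ∀ (x : Fin (k + 2) → ℝ) (i : Fin (k + 2)),
      |M fun j => x (i.succAbove j)| ≤ ∑ j, |x j| := by
    intro x i
    obtain ⟨l, _, hl⟩ := Finset.exists_mem_eq_sup' (Finset.univ_nonempty (α := Fin (k+1)))
      (fun j => x (i.succAbove j))
    have : (M fun j => x (i.succAbove j)) = x (i.succAbove l) := hl
    rw [this]
    exact Finset.single_le_sum (f := fun j => |x j|) (fun j _ => abs_nonneg _) (Finset.mem_univ _)
  have hMx : ∀ i : Fin (k + 2),
      Measurable (fun x : Fin (k + 2) → ℝ => M fun j => x (i.succAbove j)) := fun i =>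
    hMm.comp (measurable_pi_lambda _ fun j => measurable_pi_apply _)
  let φ₁ : Fin (k + 2) → ℝ → ℝ → ℝ := fun i t m => if m < t then max 0 (ψ i t) + m else 0
  let φ₂ : Fin (k + 2) → ℝ → ℝ → ℝ := fun i t m => if m < t ∧ r i ≤ t then max (r i) m else 0
  set P := Measure.pi (fun i => valueMeasure (f i)) with hP
  have hsumi : Integrable (fun x : Fin (k + 2) → ℝ => ∑ j, |x j|) P :=
    integrable_finsetSum _ fun j _ =>
      (integrable_comp_eval (μ := fun i => valueMeasure (f i)) (i := j) (f := fun t : ℝ => t) (hexp j)).abs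
  have hψP : ∀ i, Integrable (fun x : Fin (k + 2) → ℝ => |ψ i (x i)|) P := fun i =>
    (integrable_comp_eval (h1 i).2.1).abs
  have hi₁ : ∀ i, Integrable (fun x => φ₁ i (x i) (M fun j => x (i.succAbove j))) P := by
    intro i
    refine ((hψP i).add hsumi).mono' ?_ (Filter.Eventually.of_forall fun x => ?_)
    · have := (h1 i).1
      refine Measurable.aestronglyMeasurable ?_
      refine Measurable.ite (measurableSet_lt (hMx i) (measurable_pi_apply i)) ?_ measurable_const
      exact (measurable_const.max (this.comp (measurable_pi_apply i))).add (hMx i)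
    · have ha := hMabs x i
      have hb : |max 0 (ψ i (x i))| ≤ |ψ i (x i)| := by
        rw [abs_of_nonneg (le_max_left _ _)]
        exact max_le (abs_nonneg _) (le_abs_self _)
      have hc := abs_nonneg (ψ i (x i))
      have hd := (abs_nonneg _).trans ha
      simp only [φ₁, Pi.add_apply, Real.norm_eq_abs]
      split_ifs
      · exact (abs_add_le _ _).trans (add_le_add hb ha)
      · rw [abs_zero]; linarith
  have hi₂ : ∀ i, Integrable (fun x => φ₂ i (x i) (M fun j => x (i.succAbove j))) P := by
    intro i
    refine ((integrable_const (r i)).add hsumi).mono' ?_ (Filter.Eventually.of_forall fun x => ?_)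
    · refine Measurable.aestronglyMeasurable ?_
      refine Measurable.ite ((measurableSet_lt (hMx i) (measurable_pi_apply i)).inter
        (measurableSet_le measurable_const (measurable_pi_apply i))) ?_ measurable_const
      exact measurable_const.max (hMx i)
    · have ha := hMabs x i
      have hd := (abs_nonneg _).trans ha
      have hr0 := hr_nonneg i
      simp only [φ₂, Pi.add_apply, Real.norm_eq_abs]
      split_ifs
      · rw [abs_of_nonneg (le_max_of_le_left hr0)]
        have := le_abs_self (M fun j => x (i.succAbove j))
        exact max_le (by linarith) (by linarith)
      · rw [abs_zero]; linarith
  have hpos : ∀ᵐ x ∂P, ∀ i, 0 < x i := ae_all_iff.2 fun i =>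
    (measurePreserving_eval (fun i => valueMeasure (f i)) i).quasiMeasurePreserving.ae
      (val_ae_pos (f i))
  have htie : ∀ᵐ x ∂P, ∀ i, x i ≠ M fun j => x (i.succAbove j) := ae_all_iff.2 fun i =>
    no_tie (fun i => valueMeasure (f i)) i M hMm (val_noatom (f i))
  have hwin : ∀ x : Fin (k + 2) → ℝ, (∀ i, x i ≠ M fun j => x (i.succAbove j)) →
      ∀ i, (M fun j => x (i.succAbove j)) < x i ↔ i = w x := by
    intro x hx i
    constructor
    · intro h
      by_contra hne
      obtain ⟨l, hl⟩ := Fin.exists_succAbove_eq (Ne.symm hne)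
      have h2 := hMge (fun j => x (i.succAbove j)) l
      simp only [hl] at h2
      have := hw_max x i
      linarith
    · rintro rfl
      refine lt_of_le_of_ne ?_ (hx _).symm
      exact Finset.sup'_le _ _ fun j _ => hw_max x _
  have hfub : ∀ i, ∫ x, φ₁ i (x i) (M fun j => x (i.succAbove j)) ∂P
      ≤ 2 * ∫ x, φ₂ i (x i) (M fun j => x (i.succAbove j)) ∂P := by
    intro i
    refine fub (fun i => valueMeasure (f i)) i M (φ₁ i) (φ₂ i) (hi₁ i) (hi₂ i) ?_
    have hy : ∀ᵐ y ∂(Measure.pi fun j => valueMeasure (f (i.succAbove j))), 0 < y 0 :=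
      (measurePreserving_eval (fun j => valueMeasure (f (i.succAbove j))) 0
        ).quasiMeasurePreserving.ae (val_ae_pos _)
    filter_upwards [hy] with y hy
    exact slice_ineq (f i) (ψ i) (r i) (hr_nonneg i) (hr_root i) (hreg i) (hprob i)
      (h1 i).2.1 (h1 i).2.2.2 (M y) (hy.le.trans (hMge y 0))
  have hlazy : ∀ᵐ x ∂P, (if r (w x) ≤ x (w x) then
            max (r (w x))
              ((Finset.univ.erase (w x)).sup'
                (by
                  rw [← Finset.card_pos, Finset.card_erase_of_mem (Finset.mem_univ _),
                    Finset.card_univ, Fintype.card_fin]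
                  omega)
                x)
          else 0) = ∑ i, φ₂ i (x i) (M fun j => x (i.succAbove j)) := by
    filter_upwards [htie] with x hx
    rw [Finset.sum_eq_single (w x)]
    · have := (hwin x hx (w x)).2 rfl
      simp only [φ₂, hers, this, true_and]
    · intro i _ hi
      have := (hwin x hx i).not.2 hi
      simp only [φ₂, this, false_and, if_false]
    · simp
  have hmy : ∀ᵐ x ∂P,
      max 0 (Finset.univ.sup' ⟨⟨0, by omega⟩, Finset.mem_univ _⟩ fun i => ψ i (x i))
        ≤ ∑ i, φ₁ i (x i) (M fun j => x (i.succAbove j)) := by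
    filter_upwards [htie, hpos] with x hx hx0
    rw [Finset.sum_eq_single (w x)]
    · have := (hwin x hx (w x)).2 rfl
      have hM0 : 0 ≤ M fun j => x ((w x).succAbove j) :=
        (hx0 _).le.trans (hMge (fun j => x ((w x).succAbove j)) 0)
      have hm0 := le_max_left 0 (ψ (w x) (x (w x)))
      simp only [φ₁, this, if_true]
      refine max_le (by linarith) (Finset.sup'_le _ _ fun j _ => ?_)
      by_cases hj : j = w x
      · rw [hj]
        have := le_max_right 0 (ψ (w x) (x (w x)))
        linarith
      · obtain ⟨l, hl⟩ := Fin.exists_succAbove_eq hj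
        have h2 := hMge (fun j => x ((w x).succAbove j)) l
        simp only [hl] at h2
        have := (h1 j).2.2.1 (x j) (hx0 j).le
        linarith
    · intro i _ hi
      have := (hwin x hx i).not.2 hi
      simp only [φ₁, this, if_false]
    · simp
  rw [integral_congr_ae hlazy, integral_finsetSum _ fun i _ => hi₂ i]
  have hA := integral_mono_of_nonneg (Filter.Eventually.of_forall fun x => le_max_left _ _)
    (integrable_finsetSum _ fun i _ => hi₁ i) hmy
  rw [integral_finsetSum _ fun i _ => hi₁ i] at hA
  simp only [Pi.zero_apply] at hA
  have hB := Finset.sum_le_sum fun i (_ : i ∈ Finset.univ) => hfub i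
  rw [← Finset.mul_sum] at hB
  linarith
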